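/- arXiv:1211.4346 — 2 statements merged into one kernel-verified Lean document; each statement's English description precedes it below -/
import Mathlib

section
/- Let A ∈ 𝓑 be nonempty with m := m(A) < ∞ and ρ := ρ(A). Then the (m+1)-fold iterate of the invariance operator is a contraction: for every bounded measurable f : X → ℝ and every x ∈ X, |(I_A^{m+1} f)(x)| ≤ ρ · sup_{y∈X} |f(y)|, where ρ < 1. -/
open MeasureTheory ProbabilityTheory

variable {X : Type*} [MeasurableSpace X]

/-- Transition operator: `(Pf)(x) = ∫ f(y) P(x,dy)`. -/
noncomputable def transOp (P : Kernel X X) (f : X → ℝ) : X → ℝ :=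
  fun x => ∫ y, f y ∂(P x)

/-- Invariance operator `I_A f = 1_A · (Pf)`. -/
noncomputable def invOp (P : Kernel X X) (A : Set X) (f : X → ℝ) : X → ℝ :=
  A.indicator (transOp P f)

/-- Invariance value functions `u_n(·;A)`. -/
noncomputable def uN (P : Kernel X X) (A : Set X) : ℕ → X → ℝ
  | 0 => A.indicator 1
  | n + 1 => invOp P A (uN P A n)

/-- `u(x;A) = lim_n u_n(x;A)` (the sequence is pointwise nonincreasing). -/
noncomputable def uFun (P : Kernel X X) (A : Set X) : X → ℝ :=
  fun x => ⨅ n, uN P A n x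

/-- Reach-avoid value functions `w_n(·;A,B)`. -/
noncomputable def wN (P : Kernel X X) (A B : Set X) : ℕ → X → ℝ
  | 0 => B.indicator 1
  | n + 1 => fun x => B.indicator 1 x + invOp P (A \ B) (wN P A B n) x

/-- `w(x;A,B) = lim_n w_n(x;A,B)` (the sequence is pointwise nondecreasing, in `[0,1]`). -/
noncomputable def wFun (P : Kernel X X) (A B : Set X) : X → ℝ :=
  fun x => ⨆ n, wN P A B n x

/-- A bounded function. -/
def BddFun (f : X → ℝ) : Prop := ∃ C : ℝ, ∀ x, |f x| ≤ C

/-- A set `S` is absorbing if `P(x,S) = 1` for all `x ∈ S`. -/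
def Absorbing (P : Kernel X X) (S : Set X) : Prop := ∀ x ∈ S, P x S = 1

/-- A set is simple if its only absorbing measurable subset is empty. -/
def Simple (P : Kernel X X) (A : Set X) : Prop :=
  ∀ S ⊆ A, MeasurableSet S → Absorbing P S → S = ∅


theorem measurable_uN (P : Kernel X X) [IsMarkovKernel P] {A : Set X} (hA : MeasurableSet A)
    (n : ℕ) : Measurable (uN P A n) := by
  induction n with
  | zero => exact measurable_one.indicator hA
  | succ n ih => exact (ih.stronglyMeasurable.integral_kernel).measurable.indicator hA

theorem uN_nonneg (P : Kernel X X) (A : Set X) (n : ℕ) (x : X) : 0 ≤ uN P A n x := by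
  induction n generalizing x with
  | zero => exact Set.indicator_nonneg (fun _ _ => zero_le_one) x
  | succ n ih => exact Set.indicator_nonneg (fun _ _ => integral_nonneg ih) x

theorem abs_invOp_le (P : Kernel X X) (A : Set X) {f g : X → ℝ} {x : X}
    (hg : Integrable g (P x)) (hfg : ∀ y, |f y| ≤ g y) : |invOp P A f x| ≤ invOp P A g x := by
  by_cases hx : x ∈ A
  · simpa only [invOp, Set.indicator_of_mem hx, transOp, Real.norm_eq_abs] using
      norm_integral_le_of_norm_le (f := f) hg (ae_of_all _ hfg)
  · simp [invOp, hx]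

theorem invOp_const (P : Kernel X X) [IsMarkovKernel P] (A : Set X) (c : ℝ) (x : X) :
    invOp P A (fun _ => c) x = c * uN P A 0 x := by
  by_cases hx : x ∈ A <;> simp [invOp, transOp, uN, hx]

theorem invOp_const_mul (P : Kernel X X) (A : Set X) (c : ℝ) (f : X → ℝ) (x : X) :
    invOp P A (fun y => c * f y) x = c * invOp P A f x := by
  by_cases hx : x ∈ A <;> simp [invOp, transOp, hx, integral_const_mul]

theorem uN_le_one (P : Kernel X X) [IsMarkovKernel P] (A : Set X) (n : ℕ) (x : X) :
    uN P A n x ≤ 1 := by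
  have h0 (x : X) : uN P A 0 x ≤ 1 :=
    Set.indicator_le_self' (fun _ _ => zero_le_one) x
  induction n generalizing x with
  | zero => exact h0 x
  | succ n ih =>
    calc uN P A (n + 1) x ≤ |invOp P A (uN P A n) x| := le_abs_self _
      _ ≤ invOp P A (fun _ => 1) x := abs_invOp_le P A (integrable_const 1)
          fun y => (abs_of_nonneg (uN_nonneg P A n y)).trans_le (ih y)
      _ ≤ 1 := by simpa [invOp_const] using h0 x

theorem integrable_uN (P : Kernel X X) [IsMarkovKernel P] {A : Set X} (hA : MeasurableSet A)
    (n : ℕ) (x : X) : Integrable (uN P A n) (P x) :=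
  .of_bound (measurable_uN P hA n).aestronglyMeasurable 1 <| ae_of_all _ fun y =>
    (abs_of_nonneg (uN_nonneg P A n y)).trans_le (uN_le_one P A n y)

theorem abs_iterate_invOp_le (P : Kernel X X) [IsMarkovKernel P] {A : Set X}
    (hA : MeasurableSet A) {f : X → ℝ} {c : ℝ} (hf : ∀ y, |f y| ≤ c) (n : ℕ) (x : X) :
    |(invOp P A)^[n + 1] f x| ≤ c * uN P A n x := by
  induction n generalizing x with
  | zero => exact (abs_invOp_le P A (integrable_const c) hf).trans_eq (invOp_const P A c x)
  | succ n ih =>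
    rw [Function.iterate_succ_apply']
    exact (abs_invOp_le P A ((integrable_uN P hA n x).const_mul c) ih).trans_eq
      (invOp_const_mul P A c _ x)

/-- if `A` is nonempty with `m := m(A) < ∞` and `ρ := ρ(A)`, then `ρ < 1` and the
`(m+1)`-fold iterate of `I_A` is a contraction: `|(I_A^{m+1} f)(x)| ≤ ρ · sup_y |f(y)|` for every
bounded measurable `f` and every `x`. -/
theorem stmt4 (P : Kernel X X) [IsMarkovKernel P] (A : Set X)
    (hA : MeasurableSet A) (hne : A.Nonempty)
    (hfin : {k : ℕ | (⨆ x, uN P A k x) < 1}.Nonempty)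
    (m : ℕ) (hm : m = sInf {k : ℕ | (⨆ x, uN P A k x) < 1})
    (ρ : ℝ) (hρ : ρ = ⨆ x, uN P A m x) :
    ρ < 1 ∧
      ∀ f : X → ℝ, Measurable f → BddFun f →
        ∀ x : X, |(invOp P A)^[m + 1] f x| ≤ ρ * ⨆ y, |f y| := by
  subst hm hρ
  refine ⟨Nat.sInf_mem hfin, fun f _ ⟨C, hC⟩ x => ?_⟩
  have hf : BddAbove (Set.range fun y => |f y|) := ⟨C, Set.forall_mem_range.2 hC⟩
  refine (abs_iterate_invOp_le P hA (le_ciSup hf) _ x).trans ?_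
  rw [mul_comm]
  exact mul_le_mul_of_nonneg_right
    (le_ciSup (f := uN P A _) ⟨1, Set.forall_mem_range.2 (uN_le_one P A _)⟩ x)
    (Real.iSup_nonneg fun y => abs_nonneg (f y))
end

section
/- Let A ∈ 𝓑 be uniformly transient, i.e. suppose there exists M < ∞ such that Σ_{n=0}^∞ (P^n 1_A)(x) ≤ M for all x ∈ A, where P^n denotes the n-fold iterate of the transition operator. Then m(A) < ∞, i.e. there exists m ∈ ℕ with sup_{x∈X} u_m(x;A) < 1. -/
open MeasureTheory ProbabilityTheory

variable {X : Type*} [MeasurableSpace X]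

/-- Measurable functions with values in `[0, 1]`. -/
def UnitBddFun (f : X → ℝ) : Prop := Measurable f ∧ ∀ x, f x ∈ Set.Icc (0 : ℝ) 1

lemma UnitBddFun.integrable {f : X → ℝ} (hf : UnitBddFun f) (μ : Measure X) [IsFiniteMeasure μ] :
    Integrable f μ :=
  Integrable.of_mem_Icc 0 1 hf.1.aemeasurable (Filter.Eventually.of_forall hf.2)

lemma unitBddFun_indicator_one {A : Set X} (hA : MeasurableSet A) :
    UnitBddFun (A.indicator (1 : X → ℝ)) := by
  refine ⟨measurable_one.indicator hA, fun x => ?_⟩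
  by_cases hx : x ∈ A <;> simp [hx]

lemma UnitBddFun.transOp {f : X → ℝ} (hf : UnitBddFun f) (P : Kernel X X) [IsMarkovKernel P] :
    UnitBddFun (transOp P f) := by
  refine ⟨hf.1.stronglyMeasurable.integral_kernel.measurable, fun x =>
    ⟨integral_nonneg fun y => (hf.2 y).1, ?_⟩⟩
  have h := integral_mono (hf.integrable (P x)) (integrable_const (1 : ℝ)) fun y => (hf.2 y).2
  simpa [_root_.transOp] using h

lemma UnitBddFun.invOp {f : X → ℝ} (hf : UnitBddFun f) (P : Kernel X X) [IsMarkovKernel P]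
    {A : Set X} (hA : MeasurableSet A) : UnitBddFun (invOp P A f) := by
  refine ⟨(hf.transOp P).1.indicator hA, fun x => ?_⟩
  by_cases hx : x ∈ A
  · simpa [_root_.invOp, hx] using (hf.transOp P).2 x
  · simp [_root_.invOp, hx]

lemma transOp_mono (P : Kernel X X) [IsMarkovKernel P] {f g : X → ℝ} (hf : UnitBddFun f)
    (hg : UnitBddFun g) (h : f ≤ g) : transOp P f ≤ transOp P g :=
  fun x => integral_mono (hf.integrable (P x)) (hg.integrable (P x)) h

lemma invOp_mono (P : Kernel X X) [IsMarkovKernel P] (A : Set X) {f g : X → ℝ}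
    (hf : UnitBddFun f) (hg : UnitBddFun g) (h : f ≤ g) : invOp P A f ≤ invOp P A g :=
  fun x => Set.indicator_le_indicator (transOp_mono P hf hg h x)

lemma unitBddFun_uN (P : Kernel X X) [IsMarkovKernel P] {A : Set X} (hA : MeasurableSet A) :
    ∀ n, UnitBddFun (uN P A n)
  | 0 => unitBddFun_indicator_one hA
  | n + 1 => (unitBddFun_uN P hA n).invOp P hA

lemma unitBddFun_iterate_transOp (P : Kernel X X) [IsMarkovKernel P] {f : X → ℝ}
    (hf : UnitBddFun f) (n : ℕ) : UnitBddFun ((transOp P)^[n] f) := by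
  induction n with
  | zero => exact hf
  | succ n ih => rw [Function.iterate_succ_apply']; exact ih.transOp P

lemma uN_antitone (P : Kernel X X) [IsMarkovKernel P] {A : Set X} (hA : MeasurableSet A) :
    Antitone (uN P A) := by
  refine antitone_nat_of_succ_le fun n => ?_
  induction n with
  | zero =>
    exact fun x => Set.indicator_le_indicator
      (((unitBddFun_indicator_one hA).transOp P).2 x).2
  | succ n ih => exact invOp_mono P A (unitBddFun_uN P hA _) (unitBddFun_uN P hA _) ih

lemma uN_le_iterate_transOp (P : Kernel X X) [IsMarkovKernel P] {A : Set X}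
    (hA : MeasurableSet A) (n : ℕ) : uN P A n ≤ (transOp P)^[n] (A.indicator 1) := by
  induction n with
  | zero => exact le_rfl
  | succ n ih =>
    rw [Function.iterate_succ_apply']
    refine le_trans ?_ (transOp_mono P (unitBddFun_uN P hA n)
      (unitBddFun_iterate_transOp P (unitBddFun_indicator_one hA) n) ih)
    exact Set.indicator_le_self' fun x _ => (((unitBddFun_uN P hA n).transOp P).2 x).1

/-- if `A` is uniformly transient, i.e. there is `M < ∞` with
`Σ_{n=0}^∞ (P^n 1_A)(x) ≤ M` for all `x ∈ A`, then `m(A) < ∞`, i.e. there is `m` with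
`sup_x u_m(x;A) < 1`. -/
theorem stmt16 (P : Kernel X X) [IsMarkovKernel P] (A : Set X) (hA : MeasurableSet A)
    (M : ℝ)
    (hut : ∀ x ∈ A, ∀ N : ℕ,
      (∑ n ∈ Finset.range N, (transOp P)^[n] (A.indicator 1) x) ≤ M) :
    ∃ m : ℕ, (⨆ x, uN P A m x) < 1 := by
  obtain ⟨N, hN⟩ := exists_nat_gt (2 * |M|)
  have hN0 : (0 : ℝ) < N := lt_of_le_of_lt (by positivity) hN
  refine ⟨N, lt_of_le_of_lt (Real.iSup_le (a := 1 / 2) (fun x => ?_) (by norm_num)) (by norm_num)⟩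
  by_cases hx : x ∈ A
  · have hsum : (N : ℝ) * uN P A N x ≤ M := by
      refine le_trans ?_ (hut x hx N)
      rw [← nsmul_eq_mul, ← Finset.card_range N, ← Finset.sum_const, Finset.card_range]
      exact Finset.sum_le_sum fun n hn =>
        (uN_antitone P hA (Finset.mem_range.1 hn).le x).trans (uN_le_iterate_transOp P hA n x)
    by_contra! h
    nlinarith [le_abs_self M]
  · refine le_trans (uN_antitone P hA (Nat.zero_le N) x) ?_
    simp [uN, hx]
end
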